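/- Let G be an automaton on m labels, Σ = {A_1,…,A_m} a finite set of real n×n matrices, l > 0 an integer and γ ≥ 0. If there exists a symmetric positive definite matrix P ∈ ℝ^{n×n} such that (Ax)ᵀP(Ax) ≤ γ^{2l} xᵀPx for all x ∈ ℝⁿ and all A ∈ Π_l, then the constrained joint spectral radius satisfies ρ(G,Σ) ≤ γ. In particular, if such P exists with γ < 1, then the constrained switching linear system S(G,Σ) is asymptotically stable. -/

import Mathlib

open Matrix Filter Topology

/-- An automaton on `m` labels: a strongly connected directed labelled graph with
node set `Fin q` and labelled edge set `E`. -/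
structure Automaton (m : ℕ) where
  q : ℕ
  hq : 0 < q
  E : Finset (Fin q × Fin q × Fin m)
  strongly_connected :
    ∀ v w : Fin q, ∃ (l : ℕ) (u : ℕ → Fin q) (σ : ℕ → Fin m),
      u 0 = v ∧ u l = w ∧ ∀ i < l, (u i, u (i + 1), σ i) ∈ E

/-- The words of length `l` accepted by the automaton `G`. -/
def Automaton.Lang {m : ℕ} (G : Automaton m) (l : ℕ) : Set (Fin l → Fin m) :=
  { w | ∃ u : ℕ → Fin G.q, ∀ i : Fin l, (u (i : ℕ), u ((i : ℕ) + 1), w i) ∈ G.E }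

/-- The product `A_{w(l-1)} ⋯ A_{w(1)} A_{w(0)}` associated to a word `w` of length `l`. -/
def wordProd {m n : ℕ} (Sig : Fin m → Matrix (Fin n) (Fin n) ℝ) {l : ℕ}
    (w : Fin l → Fin m) : Matrix (Fin n) (Fin n) ℝ :=
  ((List.finRange l).reverse.map (fun i => Sig (w i))).prod

/-- `Π_l`: the set of products of matrices of `Σ` along words of length `l` accepted by `G`. -/
def prodSet {m n : ℕ} (G : Automaton m) (Sig : Fin m → Matrix (Fin n) (Fin n) ℝ)
    (l : ℕ) : Set (Matrix (Fin n) (Fin n) ℝ) :=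
  { M | ∃ w ∈ G.Lang l, M = wordProd Sig w }

/-- The set of products `B_t ⋯ B_1` of `t` matrices taken from the set `M`. -/
def productsOf {n : ℕ} (M : Set (Matrix (Fin n) (Fin n) ℝ)) (t : ℕ) :
    Set (Matrix (Fin n) (Fin n) ℝ) :=
  { A | ∃ B : Fin t → Matrix (Fin n) (Fin n) ℝ, (∀ i, B i ∈ M) ∧
      A = ((List.finRange t).reverse.map B).prod }
/-- coordinates are controlled by the quadratic form -/
lemma coord_sq_le {n : ℕ} (P : Matrix (Fin n) (Fin n) ℝ) (hs : P.IsSymm) (hP : P.PosDef) (i : Fin n) :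
    ∃ c : ℝ, 0 ≤ c ∧ ∀ y : Fin n → ℝ, (y i) ^ 2 ≤ c * (y ⬝ᵥ (P *ᵥ y)) := by
  have hnn : ∀ y : Fin n → ℝ, 0 ≤ y ⬝ᵥ (P *ᵥ y) := fun y => by
    simpa using hP.posSemidef.dotProduct_mulVec_nonneg y
  set z : Fin n → ℝ := P⁻¹ *ᵥ Pi.single i 1 with hz
  have hdet : IsUnit P.det := hP.det_pos.ne'.isUnit
  have hPz : P *ᵥ z = Pi.single i 1 := by
    rw [hz, Matrix.mulVec_mulVec, Matrix.mul_nonsing_inv _ hdet, Matrix.one_mulVec]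
  have hzz : 0 ≤ z i := by
    have := hnn z
    rwa [hPz, dotProduct_single, mul_one] at this
  refine ⟨z i + 1, by linarith, fun y => ?_⟩
  have hzy : z ⬝ᵥ (P *ᵥ y) = y i := by
    rw [Matrix.dotProduct_mulVec, ← Matrix.mulVec_transpose, hs.eq, hPz, single_dotProduct, one_mul]
  have h := hnn (y - (y i / (z i + 1)) • z)
  rw [Matrix.mulVec_sub, Matrix.mulVec_smul, hPz, sub_dotProduct, dotProduct_sub, dotProduct_sub,
    smul_dotProduct, smul_dotProduct, dotProduct_smul, dotProduct_smul, hzy,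
    dotProduct_single, dotProduct_single] at h
  simp only [smul_eq_mul, mul_one] at h
  set s := y i / (z i + 1) with hs'
  have hsy : y i = s * (z i + 1) := by
    rw [hs']; field_simp
  set V := y ⬝ᵥ (P *ᵥ y)
  have h2 : s ^ 2 * (z i + 1) ≤ V := by
    rw [hsy] at h
    nlinarith [sq_nonneg s]
  rw [hsy]
  nlinarith

lemma wordProd_succ {m n : ℕ} (Sig : Fin m → Matrix (Fin n) (Fin n) ℝ) {l : ℕ}
    (w : Fin (l + 1) → Fin m) :
    wordProd Sig w = Sig (w (Fin.last l)) * wordProd Sig (fun i : Fin l => w i.castSucc) := by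
  simp [wordProd, List.finRange_succ_last, List.map_map, Function.comp_def, ← List.map_reverse]

lemma traj_eq {m n : ℕ} (Sig : Fin m → Matrix (Fin n) (Fin n) ℝ) (σ : ℕ → Fin m)
    (x : ℕ → Fin n → ℝ) (hx : ∀ t, x (t + 1) = Sig (σ t) *ᵥ x t) (s l : ℕ) :
    x (s + l) = wordProd Sig (fun i : Fin l => σ (s + i)) *ᵥ x s := by
  induction l with
  | zero => simp [wordProd]
  | succ l ih =>
    rw [wordProd_succ, ← Matrix.mulVec_mulVec, ← add_assoc, hx, ih]
    simp

lemma V_decay {m n : ℕ} (G : Automaton m)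
    (Sig : Fin m → Matrix (Fin n) (Fin n) ℝ) (l : ℕ) (γ : ℝ)
    (P : Matrix (Fin n) (Fin n) ℝ)
    (hLyap : ∀ (x : Fin n → ℝ), ∀ A ∈ prodSet G Sig l,
      (A *ᵥ x) ⬝ᵥ (P *ᵥ (A *ᵥ x)) ≤ γ ^ (2 * l) * (x ⬝ᵥ (P *ᵥ x)))
    (σ : ℕ → Fin m) (u : ℕ → Fin G.q)
    (x : ℕ → Fin n → ℝ) (hx : ∀ t, x (t + 1) = Sig (σ t) *ᵥ x t) (s k : ℕ)
    (hu : ∀ t < s + k * l, (u t, u (t + 1), σ t) ∈ G.E) :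
    x (s + k * l) ⬝ᵥ (P *ᵥ x (s + k * l)) ≤ (γ ^ (2 * l)) ^ k * (x s ⬝ᵥ (P *ᵥ x s)) := by
  induction k with
  | zero => simp
  | succ k ih =>
    have e : s + (k + 1) * l = (s + k * l) + l := by ring
    rw [e, traj_eq Sig σ x hx (s + k * l) l]
    refine (hLyap _ _ ⟨_, ⟨fun i => u (s + k * l + i), fun i => ?_⟩, rfl⟩).trans ?_
    · exact hu _ (by have := i.2; rw [e]; omega)
    · rw [pow_succ', mul_assoc]
      refine mul_le_mul_of_nonneg_left (ih fun t ht => hu t (by rw [e]; omega)) ?_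
      rw [pow_mul]; positivity

lemma prod_decay {m n : ℕ} (G : Automaton m)
    (Sig : Fin m → Matrix (Fin n) (Fin n) ℝ) (l : ℕ) (hl : 0 < l) (γ : ℝ)
    (P : Matrix (Fin n) (Fin n) ℝ)
    (hLyap : ∀ (x : Fin n → ℝ), ∀ A ∈ prodSet G Sig l,
      (A *ᵥ x) ⬝ᵥ (P *ᵥ (A *ᵥ x)) ≤ γ ^ (2 * l) * (x ⬝ᵥ (P *ᵥ x)))
    (k : ℕ) (hk : 0 < k) (A : Matrix (Fin n) (Fin n) ℝ) (hA : A ∈ prodSet G Sig (k * l))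
    (y : Fin n → ℝ) :
    (A *ᵥ y) ⬝ᵥ (P *ᵥ (A *ᵥ y)) ≤ (γ ^ (k * l)) ^ 2 * (y ⬝ᵥ (P *ᵥ y)) := by
  obtain ⟨w, ⟨u, hu⟩, rfl⟩ := hA
  have hkl : 0 < k * l := Nat.mul_pos hk hl
  let σ : ℕ → Fin m := fun i => if h : i < k * l then w ⟨i, h⟩ else w ⟨0, hkl⟩
  let x : ℕ → Fin n → ℝ := fun t => Nat.rec y (fun t z => Sig (σ t) *ᵥ z) t
  have hx : ∀ t, x (t + 1) = Sig (σ t) *ᵥ x t := fun t => rfl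
  have h := V_decay G Sig l γ P hLyap σ u x hx 0 k (fun t ht => by
    rw [zero_add] at ht
    have := hu ⟨t, ht⟩
    simpa [σ, ht] using this)
  have e := traj_eq Sig σ x hx 0 (k * l)
  have e2 : (fun i : Fin (k * l) => σ (0 + i)) = w := by
    funext i
    simp [σ]
  rw [e2] at e
  rw [e] at h
  have e3 : (γ ^ (2 * l)) ^ k = (γ ^ (k * l)) ^ 2 := by
    rw [← pow_mul, ← pow_mul]; congr 1; ring
  rw [e3] at h
  exact h

/-- If there exists a symmetric positive definite `P` with
`(Ax)ᵀP(Ax) ≤ γ^{2l} xᵀPx` for all `x` and all `A ∈ Π_l`, then `ρ(G,Σ) ≤ γ`;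
in particular if moreover `γ < 1` then the constrained switching linear system
`S(G,Σ)` is asymptotically stable (every trajectory generated along an accepted
infinite word converges to `0`). -/
theorem cjsr_le_of_CQLF {m n : ℕ} (G : Automaton m)
    (Sig : Fin m → Matrix (Fin n) (Fin n) ℝ)
    (ν : Matrix (Fin n) (Fin n) ℝ → ℝ)
    (hν0 : ∀ A, 0 ≤ ν A)
    (hνeq : ∀ A, ν A = 0 ↔ A = 0)
    (hνsmul : ∀ (c : ℝ) (A), ν (c • A) = |c| * ν A)
    (hνadd : ∀ A B, ν (A + B) ≤ ν A + ν B)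
    (hνmul : ∀ A B, ν (A * B) ≤ ν A * ν B)
    (l : ℕ) (hl : 0 < l) (γ : ℝ) (hγ : 0 ≤ γ)
    (ρG : ℝ)
    (hρG : Tendsto (fun t : ℕ => sSup (ν '' prodSet G Sig t) ^ ((t : ℝ)⁻¹))
      atTop (𝓝 ρG))
    (P : Matrix (Fin n) (Fin n) ℝ) (hPsymm : P.IsSymm) (hPpos : P.PosDef)
    (hLyap : ∀ (x : Fin n → ℝ), ∀ A ∈ prodSet G Sig l,
      (A *ᵥ x) ⬝ᵥ (P *ᵥ (A *ᵥ x)) ≤ γ ^ (2 * l) * (x ⬝ᵥ (P *ᵥ x))) :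
    ρG ≤ γ ∧
    (γ < 1 → ∀ (σ : ℕ → Fin m) (u : ℕ → Fin G.q) (x : ℕ → Fin n → ℝ),
      (∀ t : ℕ, (u t, u (t + 1), σ t) ∈ G.E) →
      (∀ t : ℕ, x (t + 1) = Sig (σ t) *ᵥ x t) →
      Tendsto x atTop (𝓝 0)) := by
  have hnn : ∀ y : Fin n → ℝ, 0 ≤ y ⬝ᵥ (P *ᵥ y) := fun y => by
    simpa using hPpos.posSemidef.dotProduct_mulVec_nonneg y
  choose c hc0 hc using coord_sq_le P hPsymm hPpos
  constructor
  · let e : Fin n → Fin n → ℝ := fun j => Pi.single j 1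
    let S : Fin n → Fin n → ℝ := fun i j => Real.sqrt (c i * (e j ⬝ᵥ (P *ᵥ e j)))
    let C : ℝ := (∑ i, ∑ j, S i j * ν (Matrix.single i j 1)) + 1
    have hCpos : 0 < C := by
      have : 0 ≤ ∑ i, ∑ j, S i j * ν (Matrix.single i j 1) :=
        Finset.sum_nonneg fun i _ => Finset.sum_nonneg fun j _ =>
          mul_nonneg (Real.sqrt_nonneg _) (hν0 _)
      simp only [C]; linarith
    have hbound : ∀ k : ℕ, 0 < k → ∀ A ∈ prodSet G Sig (k * l), ν A ≤ C * γ ^ (k * l) := by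
      intro k hk A hA
      have hent : ∀ i j, |A i j| ≤ S i j * γ ^ (k * l) := by
        intro i j
        refine abs_le_of_sq_le_sq ?_ (mul_nonneg (Real.sqrt_nonneg _) (pow_nonneg hγ _))
        have h1 := prod_decay G Sig l hl γ P hLyap k hk A hA (e j)
        have h2 := hc i (A *ᵥ e j)
        have h3 : (A *ᵥ e j) i = A i j := by simp [e]
        rw [h3] at h2
        rw [mul_pow, Real.sq_sqrt (mul_nonneg (hc0 i) (hnn _))]
        have h4 := mul_le_mul_of_nonneg_left h1 (hc0 i)
        nlinarith
      have hν00 : ν 0 ≤ 0 := ((hνeq 0).2 rfl).le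
      calc ν A = ν (∑ i, ∑ j, Matrix.single i j (A i j)) := by
            rw [← Matrix.matrix_eq_sum_single]
        _ ≤ ∑ i, ν (∑ j, Matrix.single i j (A i j)) :=
            Finset.le_sum_of_subadditive ν hν00 hνadd _ _
        _ ≤ ∑ i, ∑ j, ν (Matrix.single i j (A i j)) :=
            Finset.sum_le_sum fun i _ => Finset.le_sum_of_subadditive ν hν00 hνadd _ _
        _ ≤ ∑ i, ∑ j, (S i j * ν (Matrix.single i j 1)) * γ ^ (k * l) := by
            refine Finset.sum_le_sum fun i _ => Finset.sum_le_sum fun j _ => ?_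
            have h5 : Matrix.single i j (A i j) = A i j • Matrix.single i j (1 : ℝ) := by
              rw [Matrix.smul_single, smul_eq_mul, mul_one]
            rw [h5, hνsmul, mul_right_comm]
            exact mul_le_mul_of_nonneg_right (hent i j) (hν0 _)
        _ = (∑ i, ∑ j, S i j * ν (Matrix.single i j 1)) * γ ^ (k * l) := by
            simp only [Finset.sum_mul]
        _ ≤ C * γ ^ (k * l) :=
            mul_le_mul_of_nonneg_right (by simp only [C]; linarith) (pow_nonneg hγ _)
    have hsub : Tendsto (fun k : ℕ => (k + 1) * l) atTop atTop :=
      tendsto_atTop_mono (fun k => by simp only [id]; nlinarith) tendsto_id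
    have hlim1 := hρG.comp hsub
    have hlim2 : Tendsto (fun k : ℕ => C ^ ((((k + 1) * l : ℕ) : ℝ)⁻¹) * γ) atTop (𝓝 γ) := by
      have h1 : Tendsto (fun k : ℕ => ((((k + 1) * l : ℕ) : ℝ)⁻¹)) atTop (𝓝 0) :=
        tendsto_inv_atTop_zero.comp (tendsto_natCast_atTop_atTop.comp hsub)
      have h2 := ((tendsto_const_nhds (x := C)).rpow h1 (Or.inl hCpos.ne')).mul_const γ
      simpa using h2
    refine le_of_tendsto_of_tendsto' hlim1 hlim2 fun k => ?_
    have hN : (k + 1) * l ≠ 0 := (Nat.mul_pos k.succ_pos hl).ne'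
    have hle : sSup (ν '' prodSet G Sig ((k + 1) * l)) ≤ C * γ ^ ((k + 1) * l) := by
      refine Real.sSup_le ?_ (mul_nonneg hCpos.le (pow_nonneg hγ _))
      rintro _ ⟨A, hA, rfl⟩
      exact hbound (k + 1) k.succ_pos A hA
    have h0 : 0 ≤ sSup (ν '' prodSet G Sig ((k + 1) * l)) := by
      refine Real.sSup_nonneg ?_
      rintro _ ⟨A, hA, rfl⟩
      exact hν0 A
    refine (Real.rpow_le_rpow h0 hle (by positivity)).trans_eq ?_
    rw [Real.mul_rpow hCpos.le (pow_nonneg hγ _), Real.pow_rpow_inv_natCast hγ hN]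
  · intro hγ1 σ u x hu hx
    let M : ℝ := ∑ r ∈ Finset.range l, x r ⬝ᵥ (P *ᵥ x r)
    have hV : ∀ t, x t ⬝ᵥ (P *ᵥ x t) ≤ (γ ^ (2 * l)) ^ (t / l) * M := by
      intro t
      have h := V_decay G Sig l γ P hLyap σ u x hx (t % l) (t / l) (fun t _ => hu t)
      rw [mul_comm (t / l) l, Nat.mod_add_div] at h
      refine h.trans (mul_le_mul_of_nonneg_left ?_ (by positivity))
      exact Finset.single_le_sum (f := fun r => x r ⬝ᵥ (P *ᵥ x r)) (fun r _ => hnn _)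
        (Finset.mem_range.2 (Nat.mod_lt _ hl))
    have hlim : Tendsto (fun t : ℕ => (γ ^ (2 * l)) ^ (t / l) * M) atTop (𝓝 0) := by
      have h1 := (tendsto_pow_atTop_nhds_zero_of_lt_one (pow_nonneg hγ (2 * l))
        (pow_lt_one₀ hγ hγ1 (by omega))).comp (Nat.tendsto_div_const_atTop hl.ne')
      simpa using h1.mul_const M
    rw [tendsto_pi_nhds]
    intro i
    have hsq : Tendsto (fun t => (x t i) ^ 2) atTop (𝓝 0) := by
      refine squeeze_zero (fun t => sq_nonneg _)
        (fun t => (hc i (x t)).trans (mul_le_mul_of_nonneg_left (hV t) (hc0 i))) ?_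
      simpa using hlim.const_mul (c i)
    have h := hsq.sqrt
    simp only [Real.sqrt_sq_eq_abs, Real.sqrt_zero] at h
    exact (tendsto_zero_iff_abs_tendsto_zero _).2 h
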